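/- For all x ∈ [0, π_{6/5,3}/4), writing c = cos_{6/5,3}(x), one has sin_{6/5,3}(2x) = 4 c^{1/5} (1 + 3 c^{3/5}) (1 − c^{3/5})^{1/3} / (1 + 24 c^{3/5} + 18 c^{6/5} − 27 c^{12/5})^{2/3}. -/

import Mathlib

open MeasureTheory Set
open scoped ENNReal

/-- `genF p q y = ∫_0^y (1 - t^q)^(-1/p) dt`, whose inverse is the generalized sine. -/
noncomputable def genF (p q y : ℝ) : ℝ := ∫ t in (0:ℝ)..y, (1 - t ^ q) ^ (-(1 / p))

/-- `genG p q y = ∫_0^y (1 + t^q)^(-1/p) dt`, whose inverse is the generalized hyperbolic sine. -/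
noncomputable def genG (p q y : ℝ) : ℝ := ∫ t in (0:ℝ)..y, (1 + t ^ q) ^ (-(1 / p))

/-- The generalized π, `π_{p,q} = 2∫_0^1 (1 - t^q)^(-1/p) dt`, as an extended real number
(it is `∞` when `q/(q+1) < p ≤ 1`). -/
noncomputable def genPi (p q : ℝ) : ℝ≥0∞ :=
  2 * ∫⁻ t in Ioo (0:ℝ) 1, ENNReal.ofReal ((1 - t ^ q) ^ (-(1 / p)))

/-- The generalized sine `sin_{p,q}`: the inverse of `genF p q`, which maps `[0,1)` onto
`[0, π_{p,q}/2)`. -/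
noncomputable def gsin (p q : ℝ) : ℝ → ℝ := Function.invFunOn (genF p q) (Ico 0 1)

/-- The generalized cosine `cos_{p,q} x = (d/dx) sin_{p,q} x` (one-sided at `x = 0`). -/
noncomputable def gcos (p q x : ℝ) : ℝ := derivWithin (gsin p q) (Ici 0) x

/-- The generalized hyperbolic sine `sinh_{p,q}`: the inverse of `genG p q`, which maps
`[0,∞)` onto `[0, π_{r,q}/2)` where `r = pq/(pq+p-q)`. -/
noncomputable def gsinh (p q : ℝ) : ℝ → ℝ := Function.invFunOn (genG p q) (Ici 0)

/-- The generalized hyperbolic cosine `cosh_{p,q} x = (d/dx) sinh_{p,q} x`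
(one-sided at `x = 0`). -/
noncomputable def gcosh (p q x : ℝ) : ℝ := derivWithin (gsinh p q) (Ici 0) x

/-- The generalized π, `π_{p,q} = 2∫_0^1 (1 - t^q)^(-1/p) dt`, as a real number
(valid for `p > 1`, where the integral converges). -/
noncomputable def genPiR (p q : ℝ) : ℝ := 2 * ∫ t in (0:ℝ)..1, (1 - t ^ q) ^ (-(1 / p))

open Filter Topology

theorem one_sub_rpow_pos {q t : ℝ} (hq : 1 ≤ q) (ht : t ∈ Ioo (-1 : ℝ) 1) : 0 < 1 - t ^ q := by
  have h1 : |t| ^ q < 1 :=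
    Real.rpow_lt_one (abs_nonneg t) (abs_lt.2 ht) (by linarith)
  linarith [le_abs_self (t ^ q), Real.abs_rpow_le_abs_rpow t q]

theorem continuousAt_genF_integrand {p q t : ℝ} (hq : 1 ≤ q) (ht : t ∈ Ioo (-1 : ℝ) 1) :
    ContinuousAt (fun t : ℝ => (1 - t ^ q) ^ (-(1 / p))) t :=
  (continuousAt_const.sub (Real.continuousAt_rpow_const t q (Or.inr (by linarith)))).rpow_const
    (Or.inl (one_sub_rpow_pos hq ht).ne')

theorem hasStrictDerivAt_genF {p q y : ℝ} (hq : 1 ≤ q) (hy : y ∈ Ioo (-1 : ℝ) 1) :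
    HasStrictDerivAt (genF p q) ((1 - y ^ q) ^ (-(1 / p))) y := by
  refine intervalIntegral.integral_hasStrictDerivAt_right ?_ ?_ (continuousAt_genF_integrand hq hy)
  · refine ContinuousOn.intervalIntegrable fun t ht => ?_
    exact (continuousAt_genF_integrand hq
      (ordConnected_Ioo.uIcc_subset (by norm_num) hy ht)).continuousWithinAt
  · exact (ContinuousOn.stronglyMeasurableAtFilter isOpen_Ioo
      fun t ht => (continuousAt_genF_integrand hq ht).continuousWithinAt) y hy

theorem intervalIntegrable_genF_integrand {p q : ℝ} (hp : 1 < p) (hq : 1 ≤ q) :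
    IntervalIntegrable (fun t : ℝ => (1 - t ^ q) ^ (-(1 / p))) volume 0 1 := by
  have hp' : 1 / p < 1 := by rw [div_lt_one (by linarith)]; exact hp
  have h := ((intervalIntegral.intervalIntegrable_rpow' (a := 0) (b := 1)
    (r := -(1 / p)) (by linarith)).comp_sub_left 1).symm
  rw [sub_zero, sub_self] at h
  refine h.mono_fun' (Measurable.aestronglyMeasurable (by fun_prop)) ?_
  rw [uIoc_of_le zero_le_one, ← restrict_Ioo_eq_restrict_Ioc]
  refine (ae_restrict_iff' measurableSet_Ioo).2 (Eventually.of_forall fun t ht => ?_)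
  have hpos := one_sub_rpow_pos hq ⟨by linarith [ht.1], ht.2⟩
  have hle : t ^ q ≤ t := by
    simpa using Real.rpow_le_rpow_of_exponent_ge ht.1 ht.2.le hq
  refine (Real.norm_of_nonneg (Real.rpow_nonneg hpos.le _)).trans_le ?_
  exact Real.rpow_le_rpow_of_nonpos (by linarith [ht.2]) (by linarith)
    (neg_nonpos.2 (by positivity))

theorem continuousOn_genF {p q : ℝ} (hp : 1 < p) (hq : 1 ≤ q) :
    ContinuousOn (genF p q) (Icc 0 1) := by
  have h := intervalIntegral.continuousOn_primitive_interval'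
    (intervalIntegrable_genF_integrand hp hq) (left_mem_uIcc (a := (0 : ℝ)))
  rwa [uIcc_of_le zero_le_one] at h

theorem deriv_genF_pos {p q y : ℝ} (hq : 1 ≤ q) (hy : y ∈ Ioo (-1 : ℝ) 1) :
    0 < deriv (genF p q) y := by
  rw [(hasStrictDerivAt_genF hq hy).hasDerivAt.deriv]
  exact Real.rpow_pos_of_pos (one_sub_rpow_pos hq hy) _

theorem strictMonoOn_genF_Ioo {p q : ℝ} (hq : 1 ≤ q) :
    StrictMonoOn (genF p q) (Ioo (-1) 1) :=
  strictMonoOn_of_deriv_pos (convex_Ioo _ _)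
    (fun _ hy => (hasStrictDerivAt_genF hq hy).hasDerivAt.continuousAt.continuousWithinAt)
    fun y hy => deriv_genF_pos hq (by rwa [interior_Ioo] at hy)

theorem genF_zero (p q : ℝ) : genF p q 0 = 0 := intervalIntegral.integral_same

theorem genPiR_eq (p q : ℝ) : genPiR p q = 2 * genF p q 1 := rfl

theorem gsin_genF {p q s : ℝ} (hq : 1 ≤ q) (hs : s ∈ Ico (0 : ℝ) 1) :
    gsin p q (genF p q s) = s :=
  ((strictMonoOn_genF_Ioo hq).mono fun _ ht => ⟨by linarith [ht.1], ht.2⟩).injOn.leftInvOn_invFunOn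
    hs

theorem gcos_genF {p q s : ℝ} (hq : 1 ≤ q) (hs : s ∈ Ico (0 : ℝ) 1) :
    gcos p q (genF p q s) = (1 - s ^ q) ^ (1 / p) := by
  have hs' : s ∈ Ioo (-1 : ℝ) 1 := ⟨by linarith [hs.1], hs.2⟩
  have hpos := one_sub_rpow_pos hq hs'
  have hF := hasStrictDerivAt_genF (p := p) hq hs'
  have hne : (1 - s ^ q) ^ (-(1 / p)) ≠ 0 := (Real.rpow_pos_of_pos hpos _).ne'
  have hmono := strictMonoOn_genF_Ioo (p := p) hq
  have h0 : (0 : ℝ) ∈ Ioo (-1 : ℝ) 1 := by norm_num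
  have hev : ∀ᶠ x in 𝓝 (genF p q s), 0 ≤ x →
      gsin p q x = hF.localInverse _ _ _ hne x := by
    rw [← hF.map_nhds_eq hne, eventually_map]
    filter_upwards [hF.eventually_left_inverse hne, isOpen_Ioo.mem_nhds hs'] with t ht htI hx
    rw [ht, gsin_genF hq ⟨?_, htI.2⟩]
    rwa [← genF_zero p q, hmono.le_iff_le h0 htI] at hx
  have hmem : genF p q s ∈ Ici (0 : ℝ) := by
    rw [mem_Ici, ← genF_zero p q, hmono.le_iff_le h0 hs']
    exact hs.1
  have hd := (hF.to_localInverse hne).hasDerivAt.hasDerivWithinAt (s := Ici 0)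
  have hd := hd.congr_of_eventuallyEq
    (eventually_nhdsWithin_iff.2 (hev.mono fun x hx hx0 => hx hx0)) (hev.self_of_nhds hmem)
  rw [gcos, hd.derivWithin (uniqueDiffOn_Ici 0 _ hmem), ← Real.rpow_neg hpos.le, neg_neg]

/-- `sin_{6/5,3}` in terms of `w = cos_{6/5,3} ^ (3/5)`. -/
noncomputable def sinOfRoot (w : ℝ) : ℝ := (1 - w) ^ ((1:ℝ) / 3) * (1 + w) ^ ((1:ℝ) / 3)

/-- The right-hand side of the double-angle formula in terms of `w = cos_{6/5,3} ^ (3/5)`. -/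
noncomputable def doubleSinOfRoot (w : ℝ) : ℝ :=
  4 * w ^ ((1:ℝ) / 3) * (1 + 3 * w) * (1 - w) ^ ((1:ℝ) / 3) /
    (1 + 24 * w + 18 * w ^ 2 - 27 * w ^ 4) ^ ((2:ℝ) / 3)

theorem rpow_third_pow {a : ℝ} (ha : 0 ≤ a) : (a ^ ((1:ℝ) / 3)) ^ 3 = a := by
  rw [← Real.rpow_natCast, ← Real.rpow_mul ha]; norm_num

theorem denom_pos {w : ℝ} (hw : w ∈ Icc (1 / 3 : ℝ) 1) :
    0 < 1 + 24 * w + 18 * w ^ 2 - 27 * w ^ 4 := by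
  obtain ⟨h1, h2⟩ := hw
  have h3 : w ^ 2 ≤ 1 := by nlinarith
  nlinarith [mul_nonneg (sq_nonneg w) (sub_nonneg.2 h3)]

theorem sinOfRoot_rpow {w : ℝ} (hw : w ∈ Icc (1 / 3 : ℝ) 1) :
    1 - sinOfRoot w ^ (3:ℝ) = w ^ 2 := by
  rw [Real.rpow_ofNat, sinOfRoot, mul_pow, rpow_third_pow (by linarith [hw.2]),
    rpow_third_pow (by linarith [hw.1])]
  ring

theorem doubleSinOfRoot_rpow {w : ℝ} (hw : w ∈ Icc (1 / 3 : ℝ) 1) :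
    1 - doubleSinOfRoot w ^ (3:ℝ) =
      ((3 * w - 1) ^ 3 * (1 + w) / (1 + 24 * w + 18 * w ^ 2 - 27 * w ^ 4)) ^ 2 := by
  have hD := denom_pos hw
  have h2 : ((1 + 24 * w + 18 * w ^ 2 - 27 * w ^ 4) ^ ((2:ℝ) / 3)) ^ 3 =
      (1 + 24 * w + 18 * w ^ 2 - 27 * w ^ 4) ^ 2 := by
    rw [← Real.rpow_natCast, ← Real.rpow_mul hD.le, ← Real.rpow_natCast]; norm_num
  rw [Real.rpow_ofNat, doubleSinOfRoot, div_pow, h2, mul_pow, mul_pow, mul_pow,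
    rpow_third_pow (by linarith [hw.1]), rpow_third_pow (by linarith [hw.2])]
  generalize hDw : 1 + 24 * w + 18 * w ^ 2 - 27 * w ^ 4 = D at hD
  field_simp
  rw [← hDw]
  ring

theorem sinOfRoot_nonneg {w : ℝ} (hw : w ∈ Icc (1 / 3 : ℝ) 1) : 0 ≤ sinOfRoot w :=
  mul_nonneg (Real.rpow_nonneg (by linarith [hw.2]) _) (Real.rpow_nonneg (by linarith [hw.1]) _)

theorem doubleSinOfRoot_nonneg {w : ℝ} (hw : w ∈ Icc (1 / 3 : ℝ) 1) : 0 ≤ doubleSinOfRoot w := by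
  have h0 : 0 ≤ w := by linarith [hw.1]
  have h1 : 0 ≤ 1 - w := by linarith [hw.2]
  have hD := denom_pos hw
  unfold doubleSinOfRoot
  positivity

theorem sinOfRoot_lt_one {w : ℝ} (hw : w ∈ Icc (1 / 3 : ℝ) 1) : sinOfRoot w < 1 := by
  have h := sinOfRoot_rpow hw
  by_contra! h1
  have h2 := Real.one_le_rpow h1 (by norm_num : (0:ℝ) ≤ 3)
  nlinarith [hw.1]

theorem doubleSinOfRoot_le_one {w : ℝ} (hw : w ∈ Icc (1 / 3 : ℝ) 1) : doubleSinOfRoot w ≤ 1 := by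
  have h := doubleSinOfRoot_rpow hw
  by_contra! h1
  have h2 := Real.one_lt_rpow h1 (by norm_num : (0:ℝ) < 3)
  linarith [sq_nonneg ((3 * w - 1) ^ 3 * (1 + w) / (1 + 24 * w + 18 * w ^ 2 - 27 * w ^ 4))]

theorem doubleSinOfRoot_lt_one {w : ℝ} (hw : w ∈ Ioc (1 / 3 : ℝ) 1) : doubleSinOfRoot w < 1 := by
  have hw' := Ioc_subset_Icc_self hw
  refine (doubleSinOfRoot_le_one hw').lt_of_ne fun h1 => ?_
  have h := doubleSinOfRoot_rpow hw'
  rw [h1, Real.one_rpow, sub_self] at h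
  have hD := denom_pos hw'
  have h3 : 0 < 3 * w - 1 := by linarith [hw.1]
  have h4 : 0 < 1 + w := by linarith [hw.1]
  exact (by positivity : 0 < ((3 * w - 1) ^ 3 * (1 + w) /
    (1 + 24 * w + 18 * w ^ 2 - 27 * w ^ 4)) ^ 2).ne h

theorem doubleSinOfRoot_third : doubleSinOfRoot (1 / 3) = 1 := by
  have h := doubleSinOfRoot_rpow (w := 1 / 3) (by norm_num)
  have h1 : doubleSinOfRoot (1 / 3) ^ (3:ℝ) = 1 := by
    norm_num at h ⊢
    linarith
  exact (Real.rpow_left_inj (doubleSinOfRoot_nonneg (by norm_num)) zero_le_one three_ne_zero).1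
    (h1.trans (Real.one_rpow 3).symm)

theorem continuous_sinOfRoot : Continuous sinOfRoot :=
  ((continuous_const.sub continuous_id).rpow_const fun _ => Or.inr (by norm_num)).mul
    ((continuous_const.add continuous_id).rpow_const fun _ => Or.inr (by norm_num))

theorem continuousOn_doubleSinOfRoot : ContinuousOn doubleSinOfRoot (Icc (1 / 3) 1) := by
  have h3 : Continuous fun w : ℝ => w ^ ((1:ℝ) / 3) :=
    continuous_id.rpow_const fun _ => Or.inr (by norm_num)
  refine ContinuousOn.div (Continuous.continuousOn ?_) (Continuous.continuousOn ?_) fun w hw =>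
    (Real.rpow_pos_of_pos (denom_pos hw) _).ne'
  · exact ((continuous_const.mul h3).mul (by fun_prop)).mul (h3.comp (by fun_prop))
  · exact Continuous.rpow_const (by fun_prop) fun _ => Or.inr (by norm_num)

theorem hasDerivAt_rpow_third {f : ℝ → ℝ} {f' w : ℝ} (hf : HasDerivAt f f' w) (h : 0 < f w) :
    HasDerivAt (fun w => f w ^ ((1:ℝ) / 3)) (f w ^ ((1:ℝ) / 3) * (f' / (3 * f w))) w := by
  convert hf.rpow_const (p := 1 / 3) (Or.inl h.ne') using 1
  rw [Real.rpow_sub_one h.ne']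
  field_simp

theorem hasDerivAt_sinOfRoot {w : ℝ} (hw : w ∈ Ioo (1 / 3 : ℝ) 1) :
    HasDerivAt sinOfRoot (sinOfRoot w * (-(2 * w) / (3 * (1 - w) * (1 + w)))) w := by
  have h1 : 0 < 1 - w := by linarith [hw.2]
  have h2 : 0 < 1 + w := by linarith [hw.1]
  refine HasDerivAt.congr_deriv (f := sinOfRoot)
    ((hasDerivAt_rpow_third ((hasDerivAt_id w).const_sub 1) h1).mul
      (hasDerivAt_rpow_third ((hasDerivAt_id w).const_add 1) h2)) ?_
  simp only [sinOfRoot, id]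
  field_simp
  ring

theorem hasDerivAt_doubleSinOfRoot {w : ℝ} (hw : w ∈ Ioo (1 / 3 : ℝ) 1) :
    HasDerivAt doubleSinOfRoot (doubleSinOfRoot w * (-((3 * w - 1) ^ 5 * (1 + w)) /
      (3 * w * (1 - w) * (1 + 3 * w) * (1 + 24 * w + 18 * w ^ 2 - 27 * w ^ 4)))) w := by
  have h0 : 0 < w := by linarith [hw.1]
  have h1 : 0 < 1 - w := by linarith [hw.2]
  have hD := denom_pos (Ioo_subset_Icc_self hw)
  have hdD : HasDerivAt (fun w : ℝ => 1 + 24 * w + 18 * w ^ 2 - 27 * w ^ 4)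
      (24 + 36 * w - 108 * w ^ 3) w := by
    refine (((((hasDerivAt_id w).const_mul 24).const_add 1).add
      ((hasDerivAt_pow 2 w).const_mul 18)).sub ((hasDerivAt_pow 4 w).const_mul 27)).congr_deriv ?_
    norm_num
    ring
  have hd := ((((hasDerivAt_rpow_third (hasDerivAt_id w) h0).const_mul 4).mul
    (((hasDerivAt_id w).const_mul 3).const_add 1)).mul
    (hasDerivAt_rpow_third ((hasDerivAt_id w).const_sub 1) h1)).div
    (hdD.rpow_const (p := 2 / 3) (Or.inl hD.ne')) (Real.rpow_pos_of_pos hD _).ne'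
  refine HasDerivAt.congr_deriv (f := doubleSinOfRoot) hd ?_
  simp only [doubleSinOfRoot, id, Pi.mul_apply]
  rw [Real.rpow_sub_one hD.ne']
  have hE := Real.rpow_pos_of_pos hD (2 / 3)
  have h4 : 1 + 3 * w ≠ 0 := by positivity
  clear hd hdD
  generalize hDw : 1 + 24 * w + 18 * w ^ 2 - 27 * w ^ 4 = D at *
  field_simp
  rw [← hDw]
  ring

theorem sinOfRoot_one : sinOfRoot 1 = 0 := by simp [sinOfRoot]

theorem doubleSinOfRoot_one : doubleSinOfRoot 1 = 0 := by simp [doubleSinOfRoot]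

theorem sq_rpow_eq {z : ℝ} (hz : 0 ≤ z) (r : ℝ) : (z ^ 2) ^ r = z ^ (2 * r) := by
  rw [← Real.rpow_natCast, ← Real.rpow_mul hz]; norm_num

/-- The differential identity behind the double-angle formula. -/
theorem doubleSinOfRoot_deriv_eq {w : ℝ} (hw : w ∈ Ioo (1 / 3 : ℝ) 1) :
    (1 - doubleSinOfRoot w ^ (3:ℝ)) ^ (-(1 / (6 / 5) : ℝ)) *
      (doubleSinOfRoot w * (-((3 * w - 1) ^ 5 * (1 + w)) /
        (3 * w * (1 - w) * (1 + 3 * w) * (1 + 24 * w + 18 * w ^ 2 - 27 * w ^ 4)))) =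
    2 * ((1 - sinOfRoot w ^ (3:ℝ)) ^ (-(1 / (6 / 5) : ℝ)) *
      (sinOfRoot w * (-(2 * w) / (3 * (1 - w) * (1 + w))))) := by
  have hw' := Ioo_subset_Icc_self hw
  have h0 : 0 < w := by linarith [hw.1]
  have h1 : 0 < 1 - w := by linarith [hw.2]
  have h2 : 0 < 1 + w := by linarith
  have h3 : 0 < 3 * w - 1 := by linarith [hw.1]
  have hD := denom_pos hw'
  rw [doubleSinOfRoot_rpow hw', sinOfRoot_rpow hw', sq_rpow_eq h0.le, sq_rpow_eq (by positivity),
    doubleSinOfRoot, sinOfRoot]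
  set D := 1 + 24 * w + 18 * w ^ 2 - 27 * w ^ 4
  have key : ∀ {z : ℝ}, 0 < z → z ^ (2 * -(1 / (6 / 5) : ℝ)) = ((z ^ ((1:ℝ) / 3)) ^ 5)⁻¹ := by
    intro z hz
    rw [← Real.rpow_natCast, ← Real.rpow_mul hz.le, ← Real.rpow_neg hz.le]
    norm_num
  have hE : D ^ ((2:ℝ) / 3) = (D ^ ((1:ℝ) / 3)) ^ 2 := by
    rw [← Real.rpow_natCast, ← Real.rpow_mul hD.le]; norm_num
  have h33 : ((3 * w - 1) ^ 3) ^ ((1:ℝ) / 3) = 3 * w - 1 := by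
    rw [← Real.rpow_natCast, ← Real.rpow_mul h3.le]; norm_num
  rw [key h0, key (by positivity), hE, Real.div_rpow (by positivity) hD.le,
    Real.mul_rpow (by positivity) h2.le, h33]
  have ea := rpow_third_pow h0.le
  have ee := rpow_third_pow h2.le
  have ed := rpow_third_pow hD.le
  have pa := Real.rpow_pos_of_pos h0 (1 / 3)
  have pb := Real.rpow_pos_of_pos h1 (1 / 3)
  have pe := Real.rpow_pos_of_pos h2 (1 / 3)
  have pd := Real.rpow_pos_of_pos hD (1 / 3)
  set a := w ^ ((1:ℝ) / 3)
  set b := (1 - w) ^ ((1:ℝ) / 3)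
  set e := (1 + w) ^ ((1:ℝ) / 3)
  set d := D ^ ((1:ℝ) / 3)
  have h4 : 1 + 3 * w ≠ 0 := by positivity
  field_simp
  have ea6 : a ^ 6 = w ^ 2 := by rw [← ea, ← pow_mul]
  have ee6 : e ^ 6 = (1 + w) ^ 2 := by rw [← ee, ← pow_mul]
  rw [ea6, ee6, ed]
  ring

theorem genF_doubleSinOfRoot {w : ℝ} (hw : w ∈ Icc (1 / 3 : ℝ) 1) :
    genF (6 / 5) 3 (doubleSinOfRoot w) = 2 * genF (6 / 5) 3 (sinOfRoot w) := by
  have hp : (1:ℝ) < 6 / 5 := by norm_num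
  have hq : (1:ℝ) ≤ 3 := by norm_num
  rcases hw.2.eq_or_lt with rfl | hlt
  · rw [sinOfRoot_one, doubleSinOfRoot_one, genF_zero, mul_zero]
  have hsub : Icc w 1 ⊆ Icc (1 / 3 : ℝ) 1 := Icc_subset_Icc_left hw.1
  have hcont : ContinuousOn (fun v => genF (6 / 5) 3 (doubleSinOfRoot v) -
      2 * genF (6 / 5) 3 (sinOfRoot v)) (Icc w 1) := by
    refine ContinuousOn.sub ?_ (continuousOn_const.mul ?_)
    · exact (continuousOn_genF hp hq).comp (continuousOn_doubleSinOfRoot.mono hsub)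
        fun v hv => ⟨doubleSinOfRoot_nonneg (hsub hv), doubleSinOfRoot_le_one (hsub hv)⟩
    · exact (continuousOn_genF hp hq).comp continuous_sinOfRoot.continuousOn
        fun v hv => ⟨sinOfRoot_nonneg (hsub hv), (sinOfRoot_lt_one (hsub hv)).le⟩
  obtain ⟨v, -, hv⟩ := exists_hasDerivAt_eq_slope _ (fun _ => 0) hlt hcont fun v hv => by
    have hvI : v ∈ Ioo (1 / 3 : ℝ) 1 := ⟨hw.1.trans_lt hv.1, hv.2⟩
    have hvI' := Ioo_subset_Icc_self hvI
    have hd := ((hasStrictDerivAt_genF (p := 6 / 5) hq ⟨by linarith [doubleSinOfRoot_nonneg hvI'],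
      doubleSinOfRoot_lt_one (Ioo_subset_Ioc_self hvI)⟩).hasDerivAt.comp v
        (hasDerivAt_doubleSinOfRoot hvI)).sub
      (((hasStrictDerivAt_genF (p := 6 / 5) hq ⟨by linarith [sinOfRoot_nonneg hvI'],
      sinOfRoot_lt_one hvI'⟩).hasDerivAt.comp v (hasDerivAt_sinOfRoot hvI)).const_mul 2)
    rwa [doubleSinOfRoot_deriv_eq hvI, sub_self] at hd
  rw [eq_comm, div_eq_zero_iff, sinOfRoot_one, doubleSinOfRoot_one, genF_zero] at hv
  rcases hv with hv | hv <;> linarith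

/-- double-angle formula for `sin_{6/5,3}` on `[0, π_{6/5,3}/4)`. -/
theorem double_angle_sin_sixfifths_three (x : ℝ) (hx0 : 0 ≤ x)
    (hx : x < genPiR (6/5) 3 / 4) (c : ℝ) (hc : c = gcos (6/5) 3 x) :
    gsin (6/5) 3 (2 * x) =
      4 * c ^ ((1:ℝ) / 5) * (1 + 3 * c ^ ((3:ℝ) / 5)) * (1 - c ^ ((3:ℝ) / 5)) ^ ((1:ℝ) / 3) /
        (1 + 24 * c ^ ((3:ℝ) / 5) + 18 * c ^ ((6:ℝ) / 5) - 27 * c ^ ((12:ℝ) / 5)) ^ ((2:ℝ) / 3) := by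
  have hp : (1:ℝ) < 6 / 5 := by norm_num
  have hq : (1:ℝ) ≤ 3 := by norm_num
  have hthird : genPiR (6 / 5) 3 / 4 = genF (6 / 5) 3 (sinOfRoot (1 / 3)) := by
    have h := genF_doubleSinOfRoot (w := 1 / 3) (by norm_num)
    rw [doubleSinOfRoot_third] at h
    rw [genPiR_eq, h]
    ring
  have hcont : ContinuousOn (fun w => genF (6 / 5) 3 (sinOfRoot w)) (Icc (1 / 3) 1) :=
    (continuousOn_genF hp hq).comp continuous_sinOfRoot.continuousOn
      fun v hv => ⟨sinOfRoot_nonneg hv, (sinOfRoot_lt_one hv).le⟩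
  obtain ⟨w, hw, rfl⟩ := intermediate_value_Icc' (by norm_num) hcont
    ⟨by simpa only [sinOfRoot_one, genF_zero] using hx0, hthird ▸ hx.le⟩
  have hw3 : 1 / 3 < w := hw.1.lt_of_ne fun h => by
    rw [hthird, ← h] at hx
    exact hx.false
  have hw0 : 0 ≤ w := by linarith
  rw [gcos_genF hq ⟨sinOfRoot_nonneg hw, sinOfRoot_lt_one hw⟩, sinOfRoot_rpow hw,
    sq_rpow_eq hw0] at hc
  have hcr (r : ℝ) : c ^ r = w ^ (5 / 3 * r) := by
    rw [hc, ← Real.rpow_mul hw0]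
    norm_num
  have h3 : c ^ ((3:ℝ) / 5) = w := by rw [hcr]; norm_num
  have h6 : c ^ ((6:ℝ) / 5) = w ^ 2 := by rw [hcr, ← Real.rpow_natCast]; norm_num
  have h12 : c ^ ((12:ℝ) / 5) = w ^ 4 := by rw [hcr, ← Real.rpow_natCast]; norm_num
  have h1 : c ^ ((1:ℝ) / 5) = w ^ ((1:ℝ) / 3) := by rw [hcr]; norm_num
  rw [h1, h3, h6, h12, ← genF_doubleSinOfRoot hw,
    gsin_genF hq ⟨doubleSinOfRoot_nonneg hw, doubleSinOfRoot_lt_one ⟨hw3, hw.2⟩⟩, doubleSinOfRoot]
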